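/- Let p be a prime, V a 3-dimensional vector space over 𝔽_p, and k an algebraic closure of 𝔽_p. The kernel of the restriction of τ to F₁ equals the image of F₂ under τ': that is, for f ∈ F₁ one has τ(f) = 0 if and only if f = τ'(f') for some f' ∈ F₂. -/

import Mathlib

open Module

/-- `Z₁`: the set of lines (1-dimensional linear subspaces) of `V`. -/
abbrev lines (p : ℕ) (V : Type) [AddCommGroup V] [Module (ZMod p) V] : Type :=
  {L : Submodule (ZMod p) V // finrank (ZMod p) L = 1}

/-- `Z₂`: the set of planes (2-dimensional linear subspaces) of `V`. -/
abbrev planes (p : ℕ) (V : Type) [AddCommGroup V] [Module (ZMod p) V] : Type :=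
  {P : Submodule (ZMod p) V // finrank (ZMod p) P = 2}

/-- The map `τ`: `(τ f)(P) = Σ_{L ∈ Z₁, L ⊆ P} f(L)`. -/
noncomputable def tau (p : ℕ) (V : Type) [AddCommGroup V] [Module (ZMod p) V]
    (k : Type) [Field k] (f : lines p V → k) (P : planes p V) : k :=
  ∑ᶠ L ∈ {L : lines p V | L.1 ≤ P.1}, f L

/-- The map `τ'`: `(τ' f')(L) = Σ_{P ∈ Z₂, L ⊆ P} f'(P)`. -/
noncomputable def tau' (p : ℕ) (V : Type) [AddCommGroup V] [Module (ZMod p) V]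
    (k : Type) [Field k] (f' : planes p V → k) (L : lines p V) : k :=
  ∑ᶠ P ∈ {P : planes p V | L.1 ≤ P.1}, f' P

open Classical in
/-- Double counting in a symmetric design with `λ = 1` and `n + 1` blocks through each point. -/
lemma aux_double {A B R : Type} [Fintype A] [Fintype B] [CommRing R] (I : A → B → Prop) (n : ℕ)
    (h1 : ∀ a, Nat.card {b // I a b} = n + 1)
    (h2 : ∀ a a', a ≠ a' → Nat.card {b // I a b ∧ I a' b} = 1) (f : A → R) (a : A) :
    (∑ b, if I a b then (∑ a', if I a' b then f a' else 0) else 0)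
      = (n : R) * f a + ∑ a', f a' := by
  have e1 : ∀ b, (if I a b then (∑ a', if I a' b then f a' else 0) else 0)
      = ∑ a', if I a b ∧ I a' b then f a' else 0 := by
    intro b
    by_cases h : I a b <;> simp [h]
  simp_rw [e1]
  rw [Finset.sum_comm]
  have e2 : ∀ a', (∑ b, if I a b ∧ I a' b then f a' else 0)
      = f a' + if a' = a then (n : R) * f a else 0 := by
    intro a'
    rw [← Finset.sum_filter, Finset.sum_const, ← Fintype.card_subtype, ← Nat.card_eq_fintype_card]
    by_cases h : a' = a
    · subst h
      simp only [and_self, h1, if_true, nsmul_eq_mul]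
      push_cast
      ring
    · rw [h2 a a' (Ne.symm h)]
      simp [h]
  simp_rw [e2, Finset.sum_add_distrib]
  simp [add_comm]

open Classical in
lemma aux_sum {A B R : Type} [Fintype A] [Fintype B] [CommRing R] (I : A → B → Prop) (n : ℕ)
    (h1 : ∀ a, Nat.card {b // I a b} = n + 1) (f : A → R) :
    (∑ b, ∑ a, if I a b then f a else 0) = ((n : R) + 1) * ∑ a, f a := by
  rw [Finset.sum_comm, Finset.mul_sum]
  refine Finset.sum_congr rfl fun a _ => ?_
  rw [← Finset.sum_filter, Finset.sum_const, ← Fintype.card_subtype, ← Nat.card_eq_fintype_card, h1]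
  simp

open Classical in
lemma aux_main {A B k : Type} [Fintype A] [Fintype B] [Field k] (p : ℕ) [Fact p.Prime]
    [CharP k p] [PerfectRing k p] (I : A → B → Prop)
    (h1 : ∀ a, Nat.card {b // I a b} = p + 1)
    (h2 : ∀ a a', a ≠ a' → Nat.card {b // I a b ∧ I a' b} = 1)
    (h3 : ∀ b, Nat.card {a // I a b} = p + 1)
    (h4 : ∀ b b', b ≠ b' → Nat.card {a // I a b ∧ I a b'} = 1)
    (f : A → k) (hf : ∑ a, f a = 0) :
    (∀ b, (∑ a, if I a b then f a else 0) = 0) ↔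
      ∃ g : B → k, ∑ b, g b = 0 ∧ ∀ a, f a = ∑ b, if I a b then g b else 0 := by
  constructor
  · intro h
    let π : WittVector p k →+* k := WittVector.constantCoeff
    have hsurj : ∀ x : k, ∃ y, π y = x := fun x => ⟨WittVector.teichmuller p x, by
      simp [π, WittVector.constantCoeff]⟩
    have hker : ∀ y, π y = 0 → ∃ z, y = p * z := by
      intro y hy
      have : y ∈ RingHom.ker π := hy
      rw [WittVector.ker_constantCoeff, Ideal.mem_span_singleton] at this
      exact this
    choose F hF using fun a => hsurj (f a)
    have hs : π (∑ a, F a) = 0 := by simp [map_sum, hF, hf]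
    obtain ⟨s, hs⟩ := hker _ hs
    have hG : ∀ b, ∃ z, (∑ a, if I a b then F a else 0) = p * z := by
      intro b
      apply hker
      rw [map_sum, ← h b]
      refine Finset.sum_congr rfl fun a _ => ?_
      split_ifs <;> simp [hF]
    choose G hG using hG
    have key : ∀ a, F a = (∑ b, if I a b then G b else 0) - s := by
      intro a
      have := aux_double I p h1 h2 F a
      simp_rw [hG] at this
      rw [hs] at this
      have e : (∑ b, if I a b then (p : WittVector p k) * G b else 0)
          = p * ∑ b, if I a b then G b else 0 := by
        rw [Finset.mul_sum]
        exact Finset.sum_congr rfl fun b _ => by split_ifs <;> simp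
      rw [e, ← mul_add] at this
      have := mul_left_cancel₀ (WittVector.p_nonzero p k) this
      rw [this]; ring
    have hfg : ∀ a, f a = ∑ b, if I a b then π (G b) - π s else 0 := by
      intro a
      have e : ∀ b, (if I a b then π (G b) - π s else 0)
          = π (if I a b then G b else 0) - (if I a b then π s else 0) := by
        intro b
        split_ifs <;> simp
      simp_rw [e]
      rw [Finset.sum_sub_distrib, ← hF, key a, map_sub, map_sum, ← Finset.sum_filter (s := Finset.univ) (f := fun _ => π s),
        Finset.sum_const, ← Fintype.card_subtype, ← Nat.card_eq_fintype_card, h1]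
      simp
    refine ⟨fun b => π (G b) - π s, ?_, hfg⟩
    have := aux_sum (fun b a => I a b) p h3 (fun b => π (G b) - π s)
    simp_rw [← hfg] at this
    rw [hf] at this
    simpa using this.symm
  · rintro ⟨g, hg, h⟩ b
    have := aux_double (fun b a => I a b) p h3 h4 g b
    simp_rw [← h] at this
    rw [this, hg]
    simp

lemma card_lines (p : ℕ) [Fact p.Prime] (W : Type) [AddCommGroup W] [Module (ZMod p) W]
    (h : finrank (ZMod p) W = 2) :
    Nat.card {L : Submodule (ZMod p) W // finrank (ZMod p) L = 1} = p + 1 := by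
  rw [← Nat.card_congr (Projectivization.equivSubmodule (ZMod p) W),
    Projectivization.card_of_finrank_two _ _ h]
  simp

section
variable (p : ℕ) [Fact p.Prime] (V : Type) [AddCommGroup V] [Module (ZMod p) V]
    [Module.Finite (ZMod p) V]

lemma card_lines_in_plane (P : planes p V) :
    Nat.card {L : lines p V // L.1 ≤ P.1} = p + 1 := by
  rw [← card_lines p P.1 P.2]
  refine Nat.card_congr (Equiv.symm ?_)
  refine Equiv.ofBijective (fun M => ⟨⟨M.1.map P.1.subtype, ?_⟩, Submodule.map_subtype_le _ _⟩) ⟨?_, ?_⟩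
  · exact (Submodule.equivMapOfInjective _ P.1.injective_subtype M.1).finrank_eq.symm.trans M.2
  · intro M M' h
    simp only [Subtype.mk.injEq] at h
    exact Subtype.ext (Submodule.map_injective_of_injective P.1.injective_subtype h)
  · rintro ⟨⟨L, hL⟩, hLP⟩
    have e : (L.comap P.1.subtype).map P.1.subtype = L := by
      rw [Submodule.map_comap_subtype]; exact inf_eq_right.2 hLP
    refine ⟨⟨L.comap P.1.subtype, ?_⟩, ?_⟩
    · rw [(Submodule.equivMapOfInjective _ P.1.injective_subtype _).finrank_eq, e, hL]
    · simp only [Subtype.mk.injEq]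
      exact e

lemma card_planes_over_line (hV : finrank (ZMod p) V = 3) (L : lines p V) :
    Nat.card {P : planes p V // L.1 ≤ P.1} = p + 1 := by
  have hq := L.1.finrank_quotient_add_finrank
  rw [L.2, hV] at hq
  have key : ∀ M : Submodule (ZMod p) (V ⧸ L.1),
      finrank (ZMod p) (M.comap L.1.mkQ) = finrank (ZMod p) M + 1 := by
    intro M
    have a1 := (M.comap L.1.mkQ).finrank_quotient_add_finrank
    have a2 := M.finrank_quotient_add_finrank
    have e : ((V ⧸ M.comap L.1.mkQ)) ≃ₗ[ZMod p] ((V ⧸ L.1) ⧸ M) := by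
      refine (Submodule.quotEquivOfEq _ _ ?_).trans ((M.mkQ.comp L.1.mkQ).quotKerEquivOfSurjective
        (M.mkQ_surjective.comp L.1.mkQ_surjective))
      rw [LinearMap.ker_comp, Submodule.ker_mkQ]
    have a3 := e.finrank_eq
    omega
  rw [← card_lines p (V ⧸ L.1) (by omega)]
  refine Nat.card_congr (Equiv.symm ?_)
  refine Equiv.ofBijective (fun M => ⟨⟨M.1.comap L.1.mkQ, ?_⟩, ?_⟩) ⟨?_, ?_⟩
  · rw [key, M.2]
  · exact Submodule.le_comap_mkQ _ _
  · intro M M' h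
    simp only [Subtype.mk.injEq] at h
    exact Subtype.ext (Submodule.comap_injective_of_surjective L.1.mkQ_surjective h)
  · rintro ⟨⟨P, hP⟩, hLP⟩
    have e : (P.map L.1.mkQ).comap L.1.mkQ = P := by
      rw [Submodule.comap_map_mkQ]; exact sup_eq_right.2 hLP
    refine ⟨⟨P.map L.1.mkQ, ?_⟩, ?_⟩
    · have := key (P.map L.1.mkQ)
      rw [e, hP] at this
      omega
    · simp only [Subtype.mk.injEq]
      exact e

lemma finrank_sup_lines (L L' : lines p V) (h : L ≠ L') :
    finrank (ZMod p) (L.1 ⊔ L'.1 : Submodule (ZMod p) V) = 2 := by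
  have a := Submodule.finrank_sup_add_finrank_inf_eq L.1 L'.1
  rw [L.2, L'.2] at a
  have b : finrank (ZMod p) (L.1 ⊓ L'.1 : Submodule (ZMod p) V) ≠ 1 := by
    intro hb
    have c1 := Submodule.eq_of_le_of_finrank_eq (inf_le_left : L.1 ⊓ L'.1 ≤ L.1) (by rw [hb, L.2])
    have c2 := Submodule.eq_of_le_of_finrank_eq (inf_le_right : L.1 ⊓ L'.1 ≤ L'.1) (by rw [hb, L'.2])
    exact h (Subtype.ext (c1.symm.trans c2))
  have c := Submodule.finrank_mono (inf_le_left : L.1 ⊓ L'.1 ≤ L.1)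
  rw [L.2] at c
  omega

lemma finrank_inf_planes (hV : finrank (ZMod p) V = 3) (P P' : planes p V) (h : P ≠ P') :
    finrank (ZMod p) (P.1 ⊓ P'.1 : Submodule (ZMod p) V) = 1 := by
  have a := Submodule.finrank_sup_add_finrank_inf_eq P.1 P'.1
  rw [P.2, P'.2] at a
  have b : finrank (ZMod p) (P.1 ⊔ P'.1 : Submodule (ZMod p) V) ≠ 2 := by
    intro hb
    have c1 := Submodule.eq_of_le_of_finrank_eq (le_sup_left : P.1 ≤ P.1 ⊔ P'.1) (by rw [hb, P.2])
    have c2 := Submodule.eq_of_le_of_finrank_eq (le_sup_right : P'.1 ≤ P.1 ⊔ P'.1) (by rw [hb, P'.2])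
    exact h (Subtype.ext (c1.trans c2.symm))
  have c := Submodule.finrank_mono (le_sup_left : P.1 ≤ P.1 ⊔ P'.1)
  have d := Submodule.finrank_le (P.1 ⊔ P'.1)
  rw [P.2] at c
  omega

lemma card_planes_two (L L' : lines p V) (h : L ≠ L') :
    Nat.card {P : planes p V // L.1 ≤ P.1 ∧ L'.1 ≤ P.1} = 1 := by
  have hr := finrank_sup_lines p V L L' h
  rw [Nat.card_eq_one_iff_exists]
  refine ⟨⟨⟨L.1 ⊔ L'.1, hr⟩, le_sup_left, le_sup_right⟩, ?_⟩
  rintro ⟨⟨P, hP⟩, h1, h2⟩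
  have := Submodule.eq_of_le_of_finrank_eq (sup_le h1 h2) (by rw [hr, hP])
  exact Subtype.ext (Subtype.ext this.symm)

lemma card_lines_two (hV : finrank (ZMod p) V = 3) (P P' : planes p V) (h : P ≠ P') :
    Nat.card {L : lines p V // L.1 ≤ P.1 ∧ L.1 ≤ P'.1} = 1 := by
  have hr := finrank_inf_planes p V hV P P' h
  rw [Nat.card_eq_one_iff_exists]
  refine ⟨⟨⟨P.1 ⊓ P'.1, hr⟩, inf_le_left, inf_le_right⟩, ?_⟩
  rintro ⟨⟨L, hL⟩, h1, h2⟩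
  have := Submodule.eq_of_le_of_finrank_eq (le_inf h1 h2) (by rw [hr, hL])
  exact Subtype.ext (Subtype.ext this)
end


/-- For `f ∈ F₁` (i.e. `Σ_{L ∈ Z₁} f(L) = 0`), one has `τ(f) = 0` if and only if
`f = τ'(f')` for some `f' ∈ F₂`: the kernel of `τ|_{F₁}` equals the image of `F₂` under `τ'`. -/
theorem stmt8 (p : ℕ) [Fact p.Prime] (V : Type) [AddCommGroup V] [Module (ZMod p) V]
    [Module.Finite (ZMod p) V] (hV : finrank (ZMod p) V = 3)
    (k : Type) [Field k] [Algebra (ZMod p) k] [IsAlgClosure (ZMod p) k]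
    (f : lines p V → k) (hf : (∑ᶠ L : lines p V, f L) = 0) :
    tau p V k f = 0 ↔
      ∃ f' : planes p V → k, (∑ᶠ P : planes p V, f' P) = 0 ∧ f = tau' p V k f' := by
  classical
  have : Finite V := Module.finite_of_finite (ZMod p)
  have : Finite (Submodule (ZMod p) V) := inferInstance
  haveI : Fintype (lines p V) := Fintype.ofFinite _
  haveI : Fintype (planes p V) := Fintype.ofFinite _
  have : CharP k p := charP_of_injective_algebraMap (algebraMap (ZMod p) k).injective p
  have : IsAlgClosed k := IsAlgClosure.isAlgClosed (ZMod p)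
  have : ExpChar k p := ExpChar.prime Fact.out
  rw [finsum_eq_sum_of_fintype] at hf
  have main := aux_main p (fun (L : lines p V) (P : planes p V) => L.1 ≤ P.1)
    (card_planes_over_line p V hV) (card_planes_two p V) (card_lines_in_plane p V)
    (card_lines_two p V hV) f hf
  have t1 : ∀ P, tau p V k f P = ∑ L : lines p V, if L.1 ≤ P.1 then f L else 0 := by
    intro P
    rw [tau, finsum_mem_def, finsum_eq_sum_of_fintype]
    simp [Set.indicator_apply]
  have t2 : ∀ g L, tau' p V k g L = ∑ P : planes p V, if L.1 ≤ P.1 then g P else 0 := by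
    intro g L
    rw [tau', finsum_mem_def, finsum_eq_sum_of_fintype]
    simp [Set.indicator_apply]
  simp only [funext_iff, t1, t2, finsum_eq_sum_of_fintype, Pi.zero_apply]
  convert main
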